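/- Let p ≥ 1 and let x_1,…,x_p be complex numbers. For n ∈ ℕ define c_{x_1,…,x_p}(n) = Σ_{n = n_1 ≥ n_2 ≥ ⋯ ≥ n_p ≥ 0} x_1^{n_1−n_2} ⋯ x_{p−1}^{n_{p−1}−n_p} x_p^{n_p} / ((n_1+1)⋯(n_{p−1}+1)). Then for all n ∈ ℕ: Σ_{k=0}^{n} (−1)^k C(n,k) c_{x_1,…,x_p}(k) = c_{1−x_1,…,1−x_p}(n), where C(n,k) is the ordinary binomial coefficient. -/

import Mathlib

open Finset

/-- Given the increments `ν = (ν_1,…,ν_p)` of a weakly decreasing chain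
`n_1 ≥ n_2 ≥ ⋯ ≥ n_p ≥ 0` (so `ν_j = n_j − n_{j+1}` for `j < p` and `ν_p = n_p`),
`tailSum ν j = ν_j + ν_{j+1} + ⋯ + ν_p` recovers `n_j`. -/
def tailSum {p : ℕ} (ν : Fin p → ℕ) (j : Fin p) : ℕ :=
  ∑ l : Fin p, if j ≤ l then ν l else 0

/-- The nested sum `c_{x_1,…,x_p}(n) = Σ_{n = n_1 ≥ n_2 ≥ ⋯ ≥ n_p ≥ 0}
x_1^{n_1−n_2} ⋯ x_{p−1}^{n_{p−1}−n_p} x_p^{n_p} / ((n_1+1)⋯(n_{p−1}+1))`,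
the sum being parametrized by the increment vectors
`ν ∈ antidiagonalTuple p n` of the chains, so that `n_j = tailSum ν (j−1)`. -/
noncomputable def cSimple (p : ℕ) (x : Fin p → ℂ) (n : ℕ) : ℂ :=
  ∑ ν ∈ Finset.Nat.antidiagonalTuple p n,
    (∏ j : Fin p, x j ^ ν j) /
      (∏ j : Fin (p - 1),
        ((tailSum ν ⟨j.1, lt_of_lt_of_le j.2 (Nat.sub_le p 1)⟩ : ℕ) + 1 : ℂ))

/-- The weighted average `(∑ m ≤ n, x ^ (n - m) * a m) / (n + 1)` of a sequence. -/
noncomputable def weightedAverage (x : ℂ) (a : ℕ → ℂ) (n : ℕ) : ℂ :=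
  (∑ m ∈ range (n + 1), x ^ (n - m) * a m) / (n + 1)

/-- The alternating binomial transform of a sequence. -/
def binomialTransform (a : ℕ → ℂ) (n : ℕ) : ℂ :=
  ∑ k ∈ range (n + 1), (-1 : ℂ) ^ k * (Nat.choose n k : ℂ) * a k

lemma weightedAverage_zero (x : ℂ) (a : ℕ → ℂ) : weightedAverage x a 0 = a 0 := by
  simp [weightedAverage]

lemma succ_mul_weightedAverage (x : ℂ) (a : ℕ → ℂ) (n : ℕ) :
    ((n : ℂ) + 1) * weightedAverage x a n = ∑ m ∈ range (n + 1), x ^ (n - m) * a m :=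
  mul_div_cancel₀ _ (Nat.cast_add_one_ne_zero n)

lemma weightedAverage_succ (x : ℂ) (a : ℕ → ℂ) (n : ℕ) :
    ((n : ℂ) + 2) * weightedAverage x a (n + 1) =
      x * (((n : ℂ) + 1) * weightedAverage x a n) + a (n + 1) := by
  have h := succ_mul_weightedAverage x a (n + 1)
  rw [sum_range_succ, Nat.sub_self, pow_zero, one_mul] at h
  rw [succ_mul_weightedAverage, mul_sum]
  convert h using 2
  · push_cast; ring
  · refine sum_congr rfl fun m hm => ?_
    rw [Nat.succ_sub (mem_range_succ_iff.mp hm), pow_succ]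
    ring

lemma eq_weightedAverage {x : ℂ} {a c : ℕ → ℂ} (h0 : c 0 = a 0)
    (h : ∀ n : ℕ, ((n : ℂ) + 2) * c (n + 1) = x * (((n : ℂ) + 1) * c n) + a (n + 1)) (n : ℕ) :
    c n = weightedAverage x a n := by
  induction n with
  | zero => rw [h0, weightedAverage_zero]
  | succ n ih =>
    have h2 : (n : ℂ) + 2 ≠ 0 := by exact_mod_cast (Nat.succ_ne_zero (n + 1))
    apply mul_left_cancel₀ h2
    rw [h, weightedAverage_succ, ih]

lemma binomialTransform_eq_sum_range_add_two (a : ℕ → ℂ) (n : ℕ) :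
    binomialTransform a n =
      ∑ k ∈ range (n + 2), (-1 : ℂ) ^ k * (Nat.choose n k : ℂ) * a k := by
  rw [sum_range_succ _ (n + 1)]
  simp [binomialTransform]

lemma binomialTransform_succ_mul (c : ℕ → ℂ) (n : ℕ) :
    binomialTransform (fun k => ((k : ℂ) + 1) * c k) (n + 1) =
      ((n : ℂ) + 2) * binomialTransform c (n + 1) - ((n : ℂ) + 1) * binomialTransform c n := by
  rw [binomialTransform_eq_sum_range_add_two c n, binomialTransform, binomialTransform,
    mul_sum, mul_sum, ← sum_sub_distrib]
  refine sum_congr rfl fun k hk => ?_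
  have hk : k ≤ n + 1 := mem_range_succ_iff.mp hk
  have h : (Nat.choose n k : ℂ) * (n + 1) = Nat.choose (n + 1) k * ((n : ℂ) + 1 - k) := by
    have := Nat.choose_mul_succ_eq n k
    rw [← Nat.cast_inj (R := ℂ)] at this
    push_cast [Nat.cast_sub hk] at this
    exact this
  linear_combination (-1 : ℂ) ^ k * c k * h

lemma binomialTransform_mul_pred (c : ℕ → ℂ) (n : ℕ) :
    binomialTransform (fun k => (k : ℂ) * c (k - 1)) (n + 1) =
      -(((n : ℂ) + 1) * binomialTransform c n) := by
  rw [binomialTransform, sum_range_succ', binomialTransform, mul_sum, ← sum_neg_distrib]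
  simp only [Nat.cast_zero, zero_mul, mul_zero, add_zero, Nat.add_sub_cancel]
  refine sum_congr rfl fun k _ => ?_
  have h : ((n : ℂ) + 1) * Nat.choose n k = Nat.choose (n + 1) (k + 1) * ((k : ℂ) + 1) := by
    exact_mod_cast Nat.add_one_mul_choose_eq n k
  push_cast
  linear_combination (-1 : ℂ) ^ k * c k * h

lemma binomialTransform_weightedAverage (x : ℂ) (a : ℕ → ℂ) (n : ℕ) :
    binomialTransform (weightedAverage x a) n =
      weightedAverage (1 - x) (binomialTransform a) n := by
  refine eq_weightedAverage (by simp [binomialTransform, weightedAverage_zero]) (fun n => ?_) n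
  set c := weightedAverage x a with hc
  have ha : ∀ k, a k = ((k : ℂ) + 1) * c k - x * (k * c (k - 1)) := by
    rintro (_ | k)
    · simp [hc, weightedAverage_zero]
    · have := weightedAverage_succ x a k
      rw [← hc] at this
      rw [Nat.add_sub_cancel]
      push_cast
      linear_combination -this
  have hD : binomialTransform a (n + 1) =
      binomialTransform (fun k => ((k : ℂ) + 1) * c k) (n + 1) -
        x * binomialTransform (fun k => (k : ℂ) * c (k - 1)) (n + 1) := by
    simp only [binomialTransform, mul_sum, ← sum_sub_distrib]
    refine sum_congr rfl fun k _ => ?_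
    rw [ha k]
    ring
  rw [hD, binomialTransform_succ_mul, binomialTransform_mul_pred]
  ring

lemma tailSum_zero {p : ℕ} (ν : Fin (p + 1) → ℕ) : tailSum ν 0 = ∑ l, ν l := by
  simp [tailSum]

lemma tailSum_cons_succ {p : ℕ} (a : ℕ) (ν : Fin p → ℕ) (j : Fin p) :
    tailSum (Fin.cons a ν : Fin (p + 1) → ℕ) j.succ = tailSum ν j := by
  simp [tailSum, Fin.sum_univ_succ]

lemma sum_antidiagonalTuple_succ {M : Type*} [AddCommMonoid M] (p n : ℕ)
    (f : (Fin (p + 1) → ℕ) → M) :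
    ∑ ν ∈ Finset.Nat.antidiagonalTuple (p + 1) n, f ν =
      ∑ m ∈ range (n + 1), ∑ ν ∈ Finset.Nat.antidiagonalTuple p m, f (Fin.cons (n - m) ν) := by
  rw [sum_sigma']
  symm
  refine sum_bij' (fun s _ => Fin.cons (n - s.1) s.2)
    (fun ν _ => ⟨n - ν 0, Fin.tail ν⟩) ?_ ?_ ?_ ?_ ?_
  · rintro ⟨m, ν⟩ h
    simp only [mem_sigma, mem_range, Finset.Nat.mem_antidiagonalTuple] at h
    simp only [Finset.Nat.mem_antidiagonalTuple, Fin.sum_univ_succ, Fin.cons_zero, Fin.cons_succ]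
    omega
  · intro ν h
    simp only [Finset.Nat.mem_antidiagonalTuple, Fin.sum_univ_succ] at h
    simp only [mem_sigma, mem_range, Finset.Nat.mem_antidiagonalTuple, Fin.tail]
    omega
  · rintro ⟨m, ν⟩ h
    simp only [mem_sigma, mem_range] at h
    have : n - (n - m) = m := by omega
    simp [this]
  · intro ν h
    simp only [Finset.Nat.mem_antidiagonalTuple, Fin.sum_univ_succ] at h
    have : n - (n - ν 0) = ν 0 := by omega
    simp [this]
  · intros
    rfl

lemma cSimple_one (x : Fin 1 → ℂ) (n : ℕ) : cSimple 1 x n = x 0 ^ n := by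
  simp [cSimple]

lemma cSimple_add_two (p : ℕ) (x : Fin (p + 2) → ℂ) :
    cSimple (p + 2) x = weightedAverage (x 0) (cSimple (p + 1) (Fin.tail x)) := by
  funext n
  rw [cSimple, sum_antidiagonalTuple_succ, weightedAverage, sum_div]
  refine sum_congr rfl fun m hm => ?_
  rw [cSimple, mul_sum, sum_div]
  refine sum_congr rfl fun ν hν => ?_
  have hsum : tailSum (Fin.cons (n - m) ν : Fin (p + 2) → ℕ) 0 = n := by
    rw [Finset.Nat.mem_antidiagonalTuple] at hν
    rw [mem_range] at hm
    rw [tailSum_zero, Fin.sum_univ_succ]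
    simp only [Fin.cons_zero, Fin.cons_succ]
    omega
  have hden : ∏ j : Fin (p + 1), ((tailSum (Fin.cons (n - m) ν : Fin (p + 2) → ℕ)
        j.castSucc : ℕ) + 1 : ℂ) =
      ((n : ℂ) + 1) * ∏ j : Fin p, ((tailSum ν j.castSucc : ℕ) + 1 : ℂ) := by
    rw [Fin.prod_univ_succ, Fin.castSucc_zero, hsum]
    simp only [Fin.castSucc_succ, tailSum_cons_succ]
  have hnum : ∏ j, x j ^ (Fin.cons (n - m) ν : Fin (p + 2) → ℕ) j =
      x 0 ^ (n - m) * ∏ j, Fin.tail x j ^ ν j := by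
    rw [Fin.prod_univ_succ]
    rfl
  refine (congrArg₂ (· / ·) hnum hden).trans ?_
  change _ = x 0 ^ (n - m) * (_ / ∏ j : Fin p, ((tailSum ν j.castSucc : ℕ) + 1 : ℂ)) / _
  rw [← mul_div_assoc, div_div, mul_comm ((n : ℂ) + 1)]

lemma binomialTransform_pow (x : ℂ) (n : ℕ) :
    binomialTransform (fun k => x ^ k) n = (1 - x) ^ n := by
  rw [sub_eq_neg_add, add_pow]
  refine sum_congr rfl fun k _ => ?_
  rw [neg_pow x, one_pow]
  ring

lemma binomialTransform_cSimple (p : ℕ) (x : Fin (p + 1) → ℂ) :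
    binomialTransform (cSimple (p + 1) x) = cSimple (p + 1) (fun j => 1 - x j) := by
  induction p with
  | zero =>
    funext n
    rw [cSimple_one, ← binomialTransform_pow]
    exact congrArg (binomialTransform · n) (funext (cSimple_one x))
  | succ p ih =>
    funext n
    rw [cSimple_add_two, binomialTransform_weightedAverage, ih, cSimple_add_two]
    rfl

/-- the duality for the sums `c_{x_1,…,x_p}(n)`:
`Σ_{k=0}^{n} (−1)^k C(n,k) c_{x_1,…,x_p}(k) = c_{1−x_1,…,1−x_p}(n)`. -/
theorem stmt14 (p : ℕ) (hp : 1 ≤ p) (x : Fin p → ℂ) (n : ℕ) :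
    ∑ k ∈ Finset.range (n + 1),
      (-1 : ℂ) ^ k * (Nat.choose n k : ℂ) * cSimple p x k
    = cSimple p (fun j => 1 - x j) n := by
  obtain ⟨q, rfl⟩ := Nat.exists_eq_add_of_le' hp
  exact congrFun (binomialTransform_cSimple q x) n
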